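/- In the setting of the main theorem's proof: let X and Y be sets that are increasing unions of subsets (X_n) and (Y_n) each carrying core-compact topologies with continuous inclusions X_n → X_{n+1} and Y_n → Y_{n+1}; let W be open in the colimit topology on ⋃_n (X_n × Y_n) and set W_n := W ∩ (X_n × Y_n). If (x, y) ∈ X_0 × Y_0 with (x, y) ∈ W, then there exist sequences of open sets U_n ⊆ X_n and V_n ⊆ Y_n with U_n ⊆ U_{n+1}, V_n ⊆ V_{n+1}, and (x, y) ∈ U_n × V_n ≪ W_n (way-below in X_n × Y_n) for every n < ω; consequently U := ⋃_n U_n and V := ⋃_n V_n are open in the colimit topologies on X and Y respectively and satisfy (x, y) ∈ U × V ⊆ W. -/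

import Mathlib

/-- `S` is way below `T` with respect to an explicitly given topology. -/
def WayBelowT {X : Type} (tX : TopologicalSpace X) (S T : Set X) : Prop :=
  ∀ (ι : Type) (U : ι → Set X), (∀ i, tX.IsOpen (U i)) → T ⊆ ⋃ i, U i →
    ∃ J : Finset ι, S ⊆ ⋃ i ∈ J, U i

/-- Core-compactness with respect to an explicitly given topology. -/
def IsCoreCompactT {X : Type} (tX : TopologicalSpace X) : Prop :=
  ∀ (x : X) (U : Set X), tX.IsOpen U → x ∈ U →
    ∃ V : Set X, tX.IsOpen V ∧ x ∈ V ∧ WayBelowT tX V U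

theorem WayBelowT.subset {X : Type} {tX : TopologicalSpace X} {S T : Set X}
    (h : WayBelowT tX S T) (hT : tX.IsOpen T) : S ⊆ T := by
  obtain ⟨J, hJ⟩ := h Unit (fun _ ↦ T) (fun _ ↦ hT) fun _ hx ↦ Set.mem_iUnion.2 ⟨(), hx⟩
  exact hJ.trans (Set.iUnion₂_subset fun _ _ ↦ subset_rfl)

theorem WayBelowT.mono {X : Type} {tX : TopologicalSpace X} {S S' T T' : Set X}
    (h : WayBelowT tX S T) (hS : S' ⊆ S) (hT : T ⊆ T') : WayBelowT tX S' T' := by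
  intro ι O hO hcov
  obtain ⟨J, hJ⟩ := h ι O hO (hT.trans hcov)
  exact ⟨J, hS.trans hJ⟩

theorem WayBelowT.biUnion {X κ : Type} {tX : TopologicalSpace X} (K : Finset κ)
    {S : κ → Set X} {T : Set X} (h : ∀ k ∈ K, WayBelowT tX (S k) T) :
    WayBelowT tX (⋃ k ∈ K, S k) T := by
  classical
  intro ι O hO hcov
  choose! J hJ using fun k hk ↦ h k hk ι O hO hcov
  refine ⟨K.biUnion J, Set.iUnion₂_subset fun k hk z hz ↦ ?_⟩
  obtain ⟨i, hi, hz⟩ := Set.mem_iUnion₂.1 (hJ k hk hz)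
  exact Set.mem_iUnion₂.2 ⟨i, Finset.mem_biUnion.2 ⟨k, hk, hi⟩, hz⟩

theorem WayBelowT.image {X Y : Type} {tX : TopologicalSpace X} {tY : TopologicalSpace Y}
    {f : X → Y} (hf : Continuous f) {S : Set X} {T : Set Y}
    (h : WayBelowT tX S (f ⁻¹' T)) : WayBelowT tY (f '' S) T := by
  intro ι O hO hcov
  obtain ⟨J, hJ⟩ := h ι (fun i ↦ f ⁻¹' O i) (fun i ↦ hf.isOpen_preimage _ (hO i))
    (by simpa only [Set.preimage_iUnion] using Set.preimage_mono hcov)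
  exact ⟨J, Set.image_subset_iff.2 (by simpa only [Set.preimage_iUnion] using hJ)⟩

theorem wayBelowT_singleton {X : Type} {tX : TopologicalSpace X} {x : X} {T : Set X}
    (hx : x ∈ T) : WayBelowT tX {x} T := by
  intro ι O _ hcov
  obtain ⟨i, hi⟩ := Set.mem_iUnion.1 (hcov hx)
  exact ⟨{i}, by simpa using hi⟩

theorem WayBelowT.prod {X Y : Type} [tX : TopologicalSpace X] [tY : TopologicalSpace Y]
    {S S' : Set X} {T T' : Set Y} (hS : WayBelowT tX S S') (hT : WayBelowT tY T T') :
    WayBelowT inferInstance (S ×ˢ T) (S' ×ˢ T') := by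
  classical
  intro ι O hO hcov
  have slice (a : S') : ∃ (G : Set X) (J : Finset ι), IsOpen G ∧ a.1 ∈ G ∧
      G ×ˢ T ⊆ ⋃ i ∈ J, O i := by
    have rect (b : T') : ∃ (i : ι) (G : Set X) (H : Set Y), IsOpen G ∧ IsOpen H ∧
        a.1 ∈ G ∧ b.1 ∈ H ∧ G ×ˢ H ⊆ O i := by
      obtain ⟨i, hi⟩ := Set.mem_iUnion.1 (hcov (Set.mk_mem_prod a.2 b.2))
      exact ⟨i, isOpen_prod_iff.1 (hO i) _ _ hi⟩
    choose i G H hG hH haG hbH hGH using rect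
    obtain ⟨K, hK⟩ := hT T' H hH fun b hb ↦ Set.mem_iUnion.2 ⟨⟨b, hb⟩, hbH ⟨b, hb⟩⟩
    refine ⟨⋂ b ∈ K, G b, K.image i, isOpen_biInter_finset fun b _ ↦ hG b,
      Set.mem_iInter₂.2 fun b _ ↦ haG b, ?_⟩
    rintro ⟨u, v⟩ ⟨hu, hv⟩
    obtain ⟨b, hb, hvb⟩ := Set.mem_iUnion₂.1 (hK hv)
    exact Set.mem_iUnion₂.2 ⟨i b, Finset.mem_image_of_mem i hb,
      hGH b ⟨Set.mem_iInter₂.1 hu b hb, hvb⟩⟩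
  choose G J hG haG hGJ using slice
  obtain ⟨K, hK⟩ := hS S' G hG fun a ha ↦ Set.mem_iUnion.2 ⟨⟨a, ha⟩, haG ⟨a, ha⟩⟩
  refine ⟨K.biUnion J, ?_⟩
  rintro ⟨u, v⟩ ⟨hu, hv⟩
  obtain ⟨a, ha, hua⟩ := Set.mem_iUnion₂.1 (hK hu)
  obtain ⟨i, hi, hz⟩ := Set.mem_iUnion₂.1 (hGJ a (Set.mk_mem_prod hua hv))
  exact Set.mem_iUnion₂.2 ⟨i, Finset.mem_biUnion.2 ⟨a, ha, hi⟩, hz⟩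

/-- A finite family of open rectangles covering a rectangle `S ×ˢ T` already covers an open
rectangle around `S ×ˢ T`. -/
theorem exists_isOpen_prod_subset_biUnion_prod {X Y ι : Type*} [TopologicalSpace X]
    [TopologicalSpace Y] {S : Set X} {T : Set Y} (J : Finset ι) {P : ι → Set X} {Q : ι → Set Y}
    (hP : ∀ i, IsOpen (P i)) (hQ : ∀ i, IsOpen (Q i)) (h : S ×ˢ T ⊆ ⋃ i ∈ J, P i ×ˢ Q i) :
    ∃ (U : Set X) (V : Set Y), IsOpen U ∧ IsOpen V ∧ S ⊆ U ∧ T ⊆ V ∧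
      U ×ˢ V ⊆ ⋃ i ∈ J, P i ×ˢ Q i := by
  classical
  let F : Finset (Finset ι) := J.powerset.filter fun K ↦ T ⊆ ⋃ i ∈ K, Q i
  refine ⟨⋃ K ∈ F, ⋂ i ∈ K, P i, ⋂ K ∈ F, ⋃ i ∈ K, Q i,
    isOpen_biUnion fun K _ ↦ isOpen_biInter_finset fun i _ ↦ hP i,
    isOpen_biInter_finset fun K _ ↦ isOpen_biUnion fun i _ ↦ hQ i, fun s hs ↦ ?_,
    Set.subset_iInter₂ fun K hK ↦ (Finset.mem_filter.1 hK).2, ?_⟩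
  · refine Set.mem_iUnion₂.2 ⟨J.filter fun i ↦ s ∈ P i, Finset.mem_filter.2
      ⟨Finset.mem_powerset.2 (Finset.filter_subset _ _), fun t ht ↦ ?_⟩,
      Set.mem_iInter₂.2 fun i hi ↦ (Finset.mem_filter.1 hi).2⟩
    obtain ⟨i, hi, hsi, hti⟩ := Set.mem_iUnion₂.1 (h (Set.mk_mem_prod hs ht))
    exact Set.mem_iUnion₂.2 ⟨i, Finset.mem_filter.2 ⟨hi, hsi⟩, hti⟩
  · rintro ⟨u, v⟩ ⟨hu, hv⟩
    obtain ⟨K, hK, huK⟩ := Set.mem_iUnion₂.1 hu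
    obtain ⟨i, hi, hvi⟩ := Set.mem_iUnion₂.1 (Set.mem_iInter₂.1 hv K hK)
    exact Set.mem_iUnion₂.2 ⟨i, Finset.mem_powerset.1 (Finset.mem_filter.1 hK).1 hi,
      Set.mem_iInter₂.1 huK i hi, hvi⟩

/-- Interpolation for rectangles in a product of core-compact spaces. -/
theorem WayBelowT.exists_isOpen_prod {X Y : Type} [tX : TopologicalSpace X]
    [tY : TopologicalSpace Y] (hX : IsCoreCompactT tX) (hY : IsCoreCompactT tY)
    {S : Set X} {T : Set Y} {W : Set (X × Y)} (hW : IsOpen W)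
    (h : WayBelowT inferInstance (S ×ˢ T) W) :
    ∃ (U : Set X) (V : Set Y), IsOpen U ∧ IsOpen V ∧ S ⊆ U ∧ T ⊆ V ∧
      WayBelowT inferInstance (U ×ˢ V) W := by
  have rect (w : W) : ∃ (P : Set X) (Q : Set Y), IsOpen P ∧ IsOpen Q ∧ w.1 ∈ P ×ˢ Q ∧
      WayBelowT inferInstance (P ×ˢ Q) W := by
    obtain ⟨P', Q', hP', hQ', hwP', hwQ', hPQ⟩ := isOpen_prod_iff.1 hW _ _ w.2
    obtain ⟨P, hP, hwP, hPP'⟩ := hX _ P' hP' hwP'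
    obtain ⟨Q, hQ, hwQ, hQQ'⟩ := hY _ Q' hQ' hwQ'
    exact ⟨P, Q, hP, hQ, ⟨hwP, hwQ⟩, (hPP'.prod hQQ').mono subset_rfl hPQ⟩
  choose P Q hP hQ hwPQ hPQ using rect
  obtain ⟨J, hJ⟩ := h W (fun w ↦ P w ×ˢ Q w) (fun w ↦ (hP w).prod (hQ w))
    fun w hw ↦ Set.mem_iUnion.2 ⟨⟨w, hw⟩, hwPQ ⟨w, hw⟩⟩
  obtain ⟨U, V, hU, hV, hSU, hTV, hUV⟩ := exists_isOpen_prod_subset_biUnion_prod J hP hQ hJ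
  exact ⟨U, V, hU, hV, hSU, hTV,
    (WayBelowT.biUnion J fun w _ ↦ hPQ w).mono hUV subset_rfl⟩

theorem monotone_image_val_of_image_inclusion_subset {α : Type*} {A : ℕ → Set α}
    (hA : ∀ n, A n ⊆ A (n + 1)) {U : ∀ n, Set (A n)}
    (hU : ∀ n, Set.inclusion (hA n) '' U n ⊆ U (n + 1)) :
    Monotone fun n ↦ (Subtype.val '' U n : Set α) := by
  refine monotone_nat_of_le_succ fun n ↦ ?_
  rintro _ ⟨a, ha, rfl⟩
  exact ⟨_, hU n ⟨a, ha, rfl⟩, rfl⟩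

/-- The union of an ascending chain of open subsets of the stages is open in the colimit. -/
theorem isOpen_iSup_coinduced_iUnion_image_val {α : Type*} {A : ℕ → Set α}
    (hA : ∀ n, A n ⊆ A (n + 1)) [tA : ∀ n, TopologicalSpace (A n)]
    (hcont : ∀ n, Continuous (Set.inclusion (hA n))) {U : ∀ n, Set (A n)}
    (hUo : ∀ n, IsOpen (U n)) (hU : ∀ n, Set.inclusion (hA n) '' U n ⊆ U (n + 1)) :
    (⨆ n, TopologicalSpace.coinduced (Subtype.val : A n → α) (tA n)).IsOpen
      (⋃ n, Subtype.val '' U n) := by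
  have hmono := monotone_image_val_of_image_inclusion_subset hA hU
  have hstage (n k : ℕ) : IsOpen ((Subtype.val : A n → α) ⁻¹' (Subtype.val '' U (n + k))) := by
    have hle : A n ⊆ A (n + k) := monotone_nat_of_le_succ hA (Nat.le_add_right n k)
    have hc : Continuous (Set.inclusion hle) := by
      induction k with
      | zero => exact continuous_id
      | succ k ih =>
        have hle' : A n ⊆ A (n + k) := monotone_nat_of_le_succ hA (Nat.le_add_right n k)
        exact (hcont (n + k)).comp (ih hle')
    convert (hUo (n + k)).preimage hc using 1
    ext a
    constructor
    · rintro ⟨b, hb, hba⟩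
      obtain rfl : b = Set.inclusion hle a := Subtype.ext hba
      exact hb
    · exact fun ha ↦ ⟨_, ha, rfl⟩
  refine isOpen_iSup_iff.2 fun n ↦ isOpen_coinduced.2 ?_
  have hshift : (⋃ k, Subtype.val '' U k : Set α) = ⋃ k, Subtype.val '' U (n + k) := by
    refine Set.Subset.antisymm (Set.iUnion_subset fun k ↦ ?_)
      (Set.iUnion_subset fun k ↦ Set.subset_iUnion (fun k ↦ (Subtype.val '' U k : Set α)) (n + k))
    exact (hmono (Nat.le_add_left k n)).trans
      (Set.subset_iUnion (fun k ↦ (Subtype.val '' U (n + k) : Set α)) k)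
  rw [hshift, Set.preimage_iUnion]
  exact isOpen_iUnion (hstage n)

/-- The key construction in the proof of the main theorem: ascending chains of
open neighbourhoods `Uₙ × Vₙ` way below `Wₙ`, whose unions are open in the
colimit topologies and satisfy `(x, y) ∈ U × V ⊆ W`. -/
theorem exists_ascending_chains_wayBelow {α β : Type}
    (A : ℕ → Set α) (B : ℕ → Set β)
    (hA : ∀ n, A n ⊆ A (n + 1)) (hB : ∀ n, B n ⊆ B (n + 1))
    (hAU : ⋃ n, A n = Set.univ) (hBU : ⋃ n, B n = Set.univ)
    (tA : ∀ n, TopologicalSpace (A n)) (tB : ∀ n, TopologicalSpace (B n))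
    (hAcc : ∀ n, IsCoreCompactT (tA n)) (hBcc : ∀ n, IsCoreCompactT (tB n))
    (hAcont : ∀ n, @Continuous (A n) (A (n + 1)) (tA n) (tA (n + 1))
      (Set.inclusion (hA n)))
    (hBcont : ∀ n, @Continuous (B n) (B (n + 1)) (tB n) (tB (n + 1))
      (Set.inclusion (hB n)))
    -- the colimit (final) topologies on `α` and `β`
    (TA : TopologicalSpace α) (TB : TopologicalSpace β)
    (hTA : TA = ⨆ n, TopologicalSpace.coinduced (Subtype.val : A n → α) (tA n))
    (hTB : TB = ⨆ n, TopologicalSpace.coinduced (Subtype.val : B n → β) (tB n))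
    -- `W` is open in the colimit topology on `⋃ n, A n × B n`
    (W : Set (α × β))
    (hW : (⨆ n, TopologicalSpace.coinduced
        (fun p : A n × B n => ((p.1 : α), (p.2 : β)))
        (@instTopologicalSpaceProd (A n) (B n) (tA n) (tB n)) :
        TopologicalSpace (α × β)).IsOpen W)
    (x : α) (y : β) (hx0 : x ∈ A 0) (hy0 : y ∈ B 0) (hxyW : (x, y) ∈ W) :
    ∃ (U : ∀ n, Set (A n)) (V : ∀ n, Set (B n)),
      (∀ n, (tA n).IsOpen (U n)) ∧ (∀ n, (tB n).IsOpen (V n)) ∧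
      (∀ n, Set.inclusion (hA n) '' U n ⊆ U (n + 1)) ∧
      (∀ n, Set.inclusion (hB n) '' V n ⊆ V (n + 1)) ∧
      (∀ n, x ∈ Subtype.val '' U n ∧ y ∈ Subtype.val '' V n) ∧
      -- `Uₙ × Vₙ` is way below `Wₙ` in `Aₙ × Bₙ`
      (∀ n, WayBelowT (@instTopologicalSpaceProd (A n) (B n) (tA n) (tB n))
        (U n ×ˢ V n)
        ((fun p : A n × B n => ((p.1 : α), (p.2 : β))) ⁻¹' W)) ∧
      -- consequently the unions are open and `(x, y) ∈ U × V ⊆ W`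
      TA.IsOpen (⋃ n, Subtype.val '' U n) ∧
      TB.IsOpen (⋃ n, Subtype.val '' V n) ∧
      (x, y) ∈ (⋃ n, Subtype.val '' U n) ×ˢ (⋃ n, Subtype.val '' V n) ∧
      (⋃ n, Subtype.val '' U n) ×ˢ (⋃ n, Subtype.val '' V n) ⊆ W := by
  let Wn (n : ℕ) : Set (A n × B n) := (fun p : A n × B n => ((p.1 : α), (p.2 : β))) ⁻¹' W
  have hWn (n : ℕ) : IsOpen (Wn n) := isOpen_coinduced.1 (isOpen_iSup_iff.1 hW n)
  let R (n : ℕ) : Type := {p : Set (A n) × Set (B n) // IsOpen p.1 ∧ IsOpen p.2 ∧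
    WayBelowT inferInstance (p.1 ×ˢ p.2) (Wn n)}
  have base : ∃ p : R 0, ⟨x, hx0⟩ ∈ p.1.1 ∧ ⟨y, hy0⟩ ∈ p.1.2 := by
    have h : WayBelowT inferInstance ({⟨x, hx0⟩} ×ˢ {⟨y, hy0⟩}) (Wn 0) := by
      rw [Set.singleton_prod_singleton]
      exact wayBelowT_singleton hxyW
    obtain ⟨U, V, hU, hV, hxU, hyV, hUV⟩ := h.exists_isOpen_prod (hAcc 0) (hBcc 0) (hWn 0)
    exact ⟨⟨(U, V), hU, hV, hUV⟩, hxU rfl, hyV rfl⟩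
  have step (n : ℕ) (p : R n) : ∃ q : R (n + 1),
      Set.inclusion (hA n) '' p.1.1 ⊆ q.1.1 ∧ Set.inclusion (hB n) '' p.1.2 ⊆ q.1.2 := by
    obtain ⟨⟨S, T⟩, hS, hT, hST⟩ := p
    have h : WayBelowT inferInstance
        ((Set.inclusion (hA n) '' S) ×ˢ (Set.inclusion (hB n) '' T)) (Wn (n + 1)) := by
      rw [Set.prod_image_image_eq]
      exact WayBelowT.image ((hAcont n).prodMap (hBcont n)) hST
    obtain ⟨U, V, hU, hV, hSU, hTV, hUV⟩ :=
      h.exists_isOpen_prod (hAcc (n + 1)) (hBcc (n + 1)) (hWn (n + 1))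
    exact ⟨⟨(U, V), hU, hV, hUV⟩, hSU, hTV⟩
  obtain ⟨p₀, hxp, hyp⟩ := base
  choose next hnextA hnextB using step
  let p (n : ℕ) : R n := Nat.rec p₀ next n
  have hUA (n : ℕ) : Set.inclusion (hA n) '' (p n).1.1 ⊆ (p (n + 1)).1.1 := hnextA n (p n)
  have hVB (n : ℕ) : Set.inclusion (hB n) '' (p n).1.2 ⊆ (p (n + 1)).1.2 := hnextB n (p n)
  have hmU := monotone_image_val_of_image_inclusion_subset hA hUA
  have hmV := monotone_image_val_of_image_inclusion_subset hB hVB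
  have hx (n : ℕ) : x ∈ Subtype.val '' (p n).1.1 := hmU (Nat.zero_le n) ⟨_, hxp, rfl⟩
  have hy (n : ℕ) : y ∈ Subtype.val '' (p n).1.2 := hmV (Nat.zero_le n) ⟨_, hyp, rfl⟩
  refine ⟨fun n ↦ (p n).1.1, fun n ↦ (p n).1.2, fun n ↦ (p n).2.1, fun n ↦ (p n).2.2.1,
    hUA, hVB, fun n ↦ ⟨hx n, hy n⟩, fun n ↦ (p n).2.2.2, ?_, ?_,
    ⟨Set.mem_iUnion.2 ⟨0, hx 0⟩, Set.mem_iUnion.2 ⟨0, hy 0⟩⟩, ?_⟩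
  · rw [hTA]
    exact isOpen_iSup_coinduced_iUnion_image_val hA hAcont (fun n ↦ (p n).2.1) hUA
  · rw [hTB]
    exact isOpen_iSup_coinduced_iUnion_image_val hB hBcont (fun n ↦ (p n).2.2.1) hVB
  · rintro ⟨u, v⟩ ⟨hu, hv⟩
    obtain ⟨m, hu⟩ := Set.mem_iUnion.1 hu
    obtain ⟨n, hv⟩ := Set.mem_iUnion.1 hv
    obtain ⟨a, ha, rfl⟩ := hmU (le_max_left m n) hu
    obtain ⟨b, hb, rfl⟩ := hmV (le_max_right m n) hv
    exact (p (max m n)).2.2.2.subset (hWn _) (Set.mk_mem_prod ha hb)
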